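/- Combustion nonlinearity with small boundary density (Conjecture 4, part (i), proved in the paper). Assume f is of combustion type (f_c) with ignition value θ ∈ (0,1), and δ ∈ (0,θ]. Let (u,g,h) be a classical solution of the free boundary problem (a) with initial datum u₀ ∈ X(h₀) on [0,∞), where additionally u₀(x) ≤ θ for all x ∈ [−h₀,h₀]. Then: (1) sup_{x ∈ [g(t),h(t)]} |u(t,x) − δ| → 0 as t → ∞; (2) the limits g_∞ := lim_{t→∞} g(t) and h_∞ := lim_{t→∞} h(t) exist and are finite; and (3) δ·(h_∞ − g_∞) = ∫_{−h₀}^{h₀} u₀(x) dx. -/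

import Mathlib

open Set Filter

/-- A function `f` is of Allee type `(f_A)` with distinguished zero `θ ∈ [0,1)`. -/
def AlleeType (f : ℝ → ℝ) (θ : ℝ) : Prop :=
  ContDiffOn ℝ 1 f (Ici (0:ℝ)) ∧ θ ∈ Ico (0:ℝ) 1 ∧
    f 0 = 0 ∧ f θ = 0 ∧ f 1 = 0 ∧
    derivWithin f (Ici (0:ℝ)) 0 ≤ 0 ∧ derivWithin f (Ici (0:ℝ)) 1 < 0 ∧
    (∀ u ∈ Icc (0:ℝ) θ, f u ≤ 0) ∧ (∀ u ∈ Ioo θ (1:ℝ), 0 < f u) ∧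
    (∀ u ∈ Ioi (1:ℝ), f u < 0) ∧ 0 < ∫ s in (0:ℝ)..1, f s

/-- `θs` is the number `θ*_f ∈ [θ,1)` attached to an Allee type `f`. -/
def IsThetaStar (f : ℝ → ℝ) (θ θs : ℝ) : Prop :=
  θs ∈ Ico θ (1:ℝ) ∧ (∫ s in (0:ℝ)..θs, f s) = 0 ∧
    ∀ u ∈ Ioc θs (1:ℝ), 0 < ∫ s in (0:ℝ)..u, f s

/-- Membership in the initial class `X(h₀)`. -/
def InX (δ h₀ : ℝ) (φ : ℝ → ℝ) : Prop :=
  ContDiffOn ℝ 2 φ (Icc (-h₀) h₀) ∧ φ (-h₀) = δ ∧ φ h₀ = δ ∧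
    ∀ x ∈ Icc (-h₀) h₀, 0 < φ x

/-- A classical solution `(u,g,h)` of the free boundary problem (with reaction
term `f = f(t,x,u)`) with initial datum `u₀ ∈ X(h₀)` on the time interval `I`. -/
structure ClassicalSolution (d δ h₀ : ℝ) (f : ℝ → ℝ → ℝ → ℝ) (u₀ : ℝ → ℝ)
    (I : Set ℝ) (u : ℝ → ℝ → ℝ) (g h : ℝ → ℝ) : Prop where
  g_reg : ContDiffOn ℝ 1 g I
  h_reg : ContDiffOn ℝ 1 h I
  g_lt_h : ∀ t ∈ I, g t < h t
  u_cont : ContinuousOn (fun p : ℝ × ℝ => u p.1 p.2)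
      {p : ℝ × ℝ | p.1 ∈ I ∧ p.2 ∈ Icc (g p.1) (h p.1)}
  ux_cont : ContinuousOn (fun p : ℝ × ℝ => deriv (u p.1) p.2)
      {p : ℝ × ℝ | p.1 ∈ I ∧ 0 < p.1 ∧ p.2 ∈ Icc (g p.1) (h p.1)}
  ut_diff : ∀ t ∈ I, 0 < t → ∀ x ∈ Ioo (g t) (h t),
      DifferentiableAt ℝ (fun s => u s x) t
  ux_diff : ∀ t ∈ I, 0 < t → ∀ x ∈ Icc (g t) (h t), DifferentiableAt ℝ (u t) x
  uxx_diff : ∀ t ∈ I, 0 < t → ∀ x ∈ Ioo (g t) (h t),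
      DifferentiableAt ℝ (deriv (u t)) x
  ut_cont : ContinuousOn (fun p : ℝ × ℝ => deriv (fun s => u s p.2) p.1)
      {p : ℝ × ℝ | p.1 ∈ I ∧ 0 < p.1 ∧ p.2 ∈ Ioo (g p.1) (h p.1)}
  uxx_cont : ContinuousOn (fun p : ℝ × ℝ => deriv (deriv (u p.1)) p.2)
      {p : ℝ × ℝ | p.1 ∈ I ∧ 0 < p.1 ∧ p.2 ∈ Ioo (g p.1) (h p.1)}
  pde : ∀ t ∈ I, 0 < t → ∀ x ∈ Ioo (g t) (h t),
      deriv (fun s => u s x) t = d * deriv (deriv (u t)) x + f t x (u t x)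
  bc_g : ∀ t ∈ I, 0 < t → u t (g t) = δ
  bc_h : ∀ t ∈ I, 0 < t → u t (h t) = δ
  stefan_g : ∀ t ∈ I, 0 < t → deriv g t = -(d / δ) * deriv (u t) (g t)
  stefan_h : ∀ t ∈ I, 0 < t → deriv h t = -(d / δ) * deriv (u t) (h t)
  g_init : g 0 = -h₀
  h_init : h 0 = h₀
  u_init : ∀ x ∈ Icc (-h₀) h₀, u 0 x = u₀ x

/-- A semi-wave pair `(c,q)` for `(f, δ, d)`. -/
def SemiWavePair (d δ : ℝ) (f : ℝ → ℝ) (c : ℝ) (q : ℝ → ℝ) : Prop :=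
  0 < c ∧ ContDiffOn ℝ 2 q (Ici (0:ℝ)) ∧
    (∀ z ∈ Ici (0:ℝ),
      d * derivWithin (derivWithin q (Ici (0:ℝ))) (Ici (0:ℝ)) z
        - c * derivWithin q (Ici (0:ℝ)) z + f (q z) = 0) ∧
    (∀ z ∈ Ioi (0:ℝ), 0 < q z) ∧ q 0 = δ ∧
    Tendsto q atTop (nhds 1) ∧
    derivWithin q (Ici (0:ℝ)) 0 = c * δ / d ∧
    ∀ z ∈ Ici (0:ℝ), 0 < derivWithin q (Ici (0:ℝ)) z

/-- Condition `(f2)` with Hölder exponent `β`. -/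
def CondF2 (f : ℝ → ℝ → ℝ → ℝ) (β : ℝ) : Prop :=
  β ∈ Ioo (0:ℝ) 1 ∧
    (∀ M > 0, ∃ C > 0, ∀ t₁ ∈ Ici (0:ℝ), ∀ t₂ ∈ Ici (0:ℝ), ∀ x₁ x₂ : ℝ,
        ∀ v ∈ Icc (0:ℝ) M,
        |f t₁ x₁ v - f t₂ x₂ v| ≤ C * (|t₁ - t₂| ^ (β / 2) + |x₁ - x₂| ^ β)) ∧
    (∀ t ∈ Ici (0:ℝ), ∀ x : ℝ, ContDiffOn ℝ 1 (f t x) (Ici (0:ℝ))) ∧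
    (∀ t ∈ Ici (0:ℝ), ∀ x : ℝ, f t x 0 = 0) ∧
    (∀ M > 0, ∃ L > 0, ∀ t ∈ Ici (0:ℝ), ∀ x : ℝ,
        ∀ v₁ ∈ Icc (0:ℝ) M, ∀ v₂ ∈ Icc (0:ℝ) M,
        |f t x v₁ - f t x v₂| ≤ L * |v₁ - v₂|)

/-- Condition `(f3)` with constant `M₀`. -/
def CondF3 (f : ℝ → ℝ → ℝ → ℝ) (M₀ : ℝ) : Prop :=
  0 < M₀ ∧ ∀ t ∈ Ici (0:ℝ), ∀ x : ℝ, ∀ v, M₀ ≤ v → f t x v < 0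

/-- Part (i) of condition `(f4)`, with upper bound function `fbar`. -/
def CondF4i (f : ℝ → ℝ → ℝ → ℝ) (fbar : ℝ → ℝ) (β : ℝ) : Prop :=
  CondF2 f β ∧ (∀ t ∈ Ici (0:ℝ), ∀ x : ℝ, f t x 1 = 0) ∧
    ContinuousOn fbar (Ici (1:ℝ)) ∧
    ∀ t ∈ Ici (0:ℝ), ∀ x : ℝ, ∀ v, 1 < v → f t x v ≤ fbar v ∧ fbar v < 0

/-- Condition `(f4)`, with bounds `fbar` (above, for `u > 1`) and
`funder` (below, of Allee type). -/
def CondF4 (f : ℝ → ℝ → ℝ → ℝ) (fbar funder : ℝ → ℝ) (θ β : ℝ) : Prop :=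
  CondF4i f fbar β ∧ AlleeType funder θ ∧
    ∀ t ∈ Ici (0:ℝ), ∀ x : ℝ, ∀ v, 0 ≤ v → funder v ≤ f t x v

/-- Combustion-type nonlinearity `(f_c)` with ignition value `θ`. -/
def CombustionType (f : ℝ → ℝ) (θ : ℝ) : Prop :=
  ContDiffOn ℝ 1 f (Ici (0:ℝ)) ∧ θ ∈ Ioo (0:ℝ) 1 ∧
    (∀ u ∈ Icc (0:ℝ) θ, f u = 0) ∧ f 1 = 0 ∧ derivWithin f (Ici (0:ℝ)) 1 < 0 ∧
    (∀ u ∈ Ioo θ (1:ℝ), 0 < f u) ∧ (∀ u ∈ Ioi (1:ℝ), f u < 0)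

/-- The (unnormalised) bistable condition `(F_b)` with constants `0 < P < Q`. -/
def CondFb (F : ℝ → ℝ) (P Q : ℝ) : Prop :=
  0 < P ∧ P < Q ∧ ContDiffOn ℝ 1 F (Ici (0:ℝ)) ∧
    F 0 = 0 ∧ F P = 0 ∧ F Q = 0 ∧
    derivWithin F (Ici (0:ℝ)) 0 < 0 ∧ derivWithin F (Ici (0:ℝ)) Q < 0 ∧
    (∀ u ∈ Ioo (0:ℝ) P, F u < 0) ∧ (∀ u ∈ Ioi Q, F u < 0) ∧
    (∀ u ∈ Ioo P Q, 0 < F u) ∧ 0 < ∫ s in (0:ℝ)..Q, F s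

lemma aux_second_deriv {φ φ' : ℝ → ℝ} {x b : ℝ}
    (h1 : ∀ᶠ y in nhds x, HasDerivAt φ (φ' y) y) (h2 : HasDerivAt φ' b x)
    (hmin : IsLocalMin φ x) : 0 ≤ b := by
  by_contra hb
  push Not at hb
  have hd : deriv φ =ᶠ[nhds x] φ' := h1.mono fun y hy => hy.deriv
  have hdd : deriv (deriv φ) x = b := by rw [hd.deriv_eq]; exact h2.deriv
  have hd0 : deriv φ x = 0 := hmin.deriv_eq_zero
  have hmax : IsLocalMax φ x :=
    isLocalMax_of_deriv_deriv_neg (by rw [hdd]; exact hb) hd0 h1.self_of_nhds.continuousAt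
  have hc : φ =ᶠ[nhds x] fun _ => φ x := by
    filter_upwards [hmin, hmax] with y hy1 hy2
    exact le_antisymm hy2 hy1
  have : deriv φ =ᶠ[nhds x] fun _ => 0 := by
    have := hc.deriv
    refine this.trans ?_
    simp
  have h3 := this.deriv_eq
  rw [hdd] at h3
  simp at h3
  linarith

lemma aux_straight_cont {g h : ℝ → ℝ} (hg : ContinuousOn g (Ici 0)) (hh : ContinuousOn h (Ici 0))
    (hgh : ∀ t ∈ Ici (0:ℝ), g t < h t) {w : ℝ → ℝ → ℝ}
    (hw : ContinuousOn (fun p : ℝ × ℝ => w p.1 p.2)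
      {p : ℝ × ℝ | p.1 ∈ Ici (0:ℝ) ∧ p.2 ∈ Icc (g p.1) (h p.1)}) :
    ContinuousOn (fun p : ℝ × ℝ => w p.1 (g p.1 + p.2 * (h p.1 - g p.1)))
      (Ici (0:ℝ) ×ˢ Icc (0:ℝ) 1) := by
  have hg' : ContinuousOn (fun p : ℝ × ℝ => g p.1) (Ici (0:ℝ) ×ˢ Icc (0:ℝ) 1) :=
    hg.comp continuousOn_fst (fun p hp => hp.1)
  have hh' : ContinuousOn (fun p : ℝ × ℝ => h p.1) (Ici (0:ℝ) ×ˢ Icc (0:ℝ) 1) :=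
    hh.comp continuousOn_fst (fun p hp => hp.1)
  have hm : ContinuousOn (fun p : ℝ × ℝ => (p.1, g p.1 + p.2 * (h p.1 - g p.1)))
      (Ici (0:ℝ) ×ˢ Icc (0:ℝ) 1) :=
    continuousOn_fst.prodMk (hg'.add (continuousOn_snd.mul (hh'.sub hg')))
  refine hw.comp hm ?_
  rintro ⟨t, y⟩ ⟨ht, hy⟩
  have := hgh t ht
  simp only [mem_Icc] at hy
  refine ⟨ht, ?_, ?_⟩ <;> simp only <;> nlinarith

lemma aux_touching {g h : ℝ → ℝ} (hg : ContinuousOn g (Ici 0)) (hh : ContinuousOn h (Ici 0))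
    (hgh : ∀ t ∈ Ici (0:ℝ), g t < h t) {w wt wx wxx : ℝ → ℝ → ℝ}
    (hw : ContinuousOn (fun p : ℝ × ℝ => w p.1 p.2)
      {p : ℝ × ℝ | p.1 ∈ Ici (0:ℝ) ∧ p.2 ∈ Icc (g p.1) (h p.1)})
    (h0 : ∀ x ∈ Icc (g 0) (h 0), 0 < w 0 x)
    (hbg : ∀ t, 0 < t → 0 < w t (g t)) (hbh : ∀ t, 0 < t → 0 < w t (h t))
    (ht : ∀ t, 0 < t → ∀ x ∈ Ioo (g t) (h t), HasDerivAt (fun s => w s x) (wt t x) t)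
    (hx : ∀ t, 0 < t → ∀ x ∈ Ioo (g t) (h t), HasDerivAt (w t) (wx t x) x)
    (hxx : ∀ t, 0 < t → ∀ x ∈ Ioo (g t) (h t), HasDerivAt (wx t) (wxx t x) x)
    (hno : ∀ t, 0 < t → ∀ x ∈ Ioo (g t) (h t), w t x = 0 → wt t x ≤ 0 → 0 ≤ wxx t x → False) :
    ∀ t, 0 ≤ t → ∀ x ∈ Icc (g t) (h t), 0 < w t x := by
  by_contra hcon
  push Not at hcon
  obtain ⟨T, hT, x1, hx1, hneg⟩ := hcon
  have hW := aux_straight_cont hg hh hgh hw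
  set W : ℝ × ℝ → ℝ := fun p => w p.1 (g p.1 + p.2 * (h p.1 - g p.1)) with hWdef
  have hKc : IsCompact (Icc (0:ℝ) T ×ˢ Icc (0:ℝ) 1) := isCompact_Icc.prod isCompact_Icc
  have hWK : ContinuousOn W (Icc (0:ℝ) T ×ˢ Icc (0:ℝ) 1) :=
    hW.mono (prod_mono (fun t ht => ht.1) (Subset.refl _))
  have hScl : IsClosed ((Icc (0:ℝ) T ×ˢ Icc (0:ℝ) 1) ∩ W ⁻¹' (Iic 0)) :=
    hWK.preimage_isClosed_of_isClosed hKc.isClosed isClosed_Iic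
  have hSc : IsCompact ((Icc (0:ℝ) T ×ˢ Icc (0:ℝ) 1) ∩ W ⁻¹' (Iic 0)) :=
    hKc.of_isClosed_subset hScl inter_subset_left
  -- reparametrisation
  have hrep : ∀ t, 0 ≤ t → ∀ x ∈ Icc (g t) (h t), ∃ y ∈ Icc (0:ℝ) 1, W (t, y) = w t x := by
    intro t ht x hx
    have hL := sub_pos.2 (hgh t ht)
    refine ⟨(x - g t) / (h t - g t), ⟨div_nonneg (by linarith [hx.1]) hL.le, ?_⟩, ?_⟩
    · rw [div_le_one hL]; linarith [hx.2]
    · simp only [hWdef]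
      congr 1
      field_simp
      ring
  obtain ⟨y1, hy1, hWy1⟩ := hrep T hT x1 hx1
  obtain ⟨⟨t, y⟩, ⟨⟨htm, hy⟩, hWle⟩, hmin⟩ := hSc.exists_isMinOn
    ⟨(T, y1), ⟨⟨⟨hT, le_rfl⟩, hy1⟩, by simpa [hWy1] using hneg⟩⟩ continuousOn_fst
  simp only [mem_preimage, mem_Iic] at hWle
  have hbefore : ∀ s, 0 ≤ s → s < t → ∀ x ∈ Icc (g s) (h s), 0 < w s x := by
    intro s hs hst x hx
    by_contra hle
    push Not at hle
    obtain ⟨z, hz, hWz⟩ := hrep s hs x hx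
    have := hmin (show (s, z) ∈ _ from ⟨⟨⟨hs, hst.le.trans htm.2⟩, hz⟩, by simpa [hWz] using hle⟩)
    simp only [Set.mem_ofPred_eq] at this
    linarith
  have hL := sub_pos.2 (hgh t htm.1)
  set x := g t + y * (h t - g t) with hxdef
  have hwx : w t x ≤ 0 := hWle
  have hxm : x ∈ Icc (g t) (h t) := by
    simp only [mem_Icc] at hy
    constructor <;> nlinarith
  have htpos : 0 < t := by
    rcases htm.1.eq_or_lt with h' | h'
    · exfalso
      have := h0 x (by rw [h']; exact hxm)
      rw [h'] at this
      linarith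
    · exact h'
  have hgt : ContinuousAt g t := hg.continuousAt (Ici_mem_nhds htpos)
  have hht : ContinuousAt h t := hh.continuousAt (Ici_mem_nhds htpos)
  have hxo : x ∈ Ioo (g t) (h t) := by
    refine ⟨lt_of_le_of_ne hxm.1 ?_, lt_of_le_of_ne hxm.2 ?_⟩
    · intro he; have := hbg t htpos; rw [he] at this; linarith
    · intro he; have := hbh t htpos; rw [← he] at this; linarith
  have hev : ∀ z ∈ Ioo (g t) (h t), ∀ᶠ s in nhdsWithin t (Iio t), 0 < w s z := by
    intro z hz
    have e1 : ∀ᶠ s in nhds t, g s < z := hgt.eventually_lt continuousAt_const hz.1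
    have e2 : ∀ᶠ s in nhds t, z < h s := continuousAt_const.eventually_lt hht hz.2
    filter_upwards [e1.filter_mono nhdsWithin_le_nhds, e2.filter_mono nhdsWithin_le_nhds,
      (eventually_gt_nhds htpos).filter_mono nhdsWithin_le_nhds, self_mem_nhdsWithin] with s a1 a2 a3 a4
    exact hbefore s a3.le a4 z ⟨a1.le, a2.le⟩
  have hnn : ∀ z ∈ Ioo (g t) (h t), 0 ≤ w t z := by
    intro z hz
    refine ge_of_tendsto ((ht t htpos z hz).continuousAt.tendsto.mono_left nhdsWithin_le_nhds)
      ((hev z hz).mono fun s hs => hs.le)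
  have hw0 : w t x = 0 := le_antisymm hwx (hnn x hxo)
  refine hno t htpos x hxo hw0 ?_ ?_
  · have hs := hasDerivAt_iff_tendsto_slope.1 (ht t htpos x hxo)
    have hs' : Tendsto (slope (fun s => w s x) t) (nhdsWithin t (Iio t)) (nhds (wt t x)) :=
      hs.mono_left (nhdsWithin_mono _ (fun s hs => ne_of_lt hs))
    refine le_of_tendsto hs' ?_
    filter_upwards [hev x hxo, self_mem_nhdsWithin] with s a1 a2
    rw [slope_def_field, hw0]
    exact div_nonpos_of_nonneg_of_nonpos (by linarith) (by have := mem_Iio.1 a2; linarith)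
  · have hnb : Ioo (g t) (h t) ∈ nhds x := Ioo_mem_nhds hxo.1 hxo.2
    refine aux_second_deriv (φ := w t) (φ' := wx t) ?_ (hxx t htpos x hxo) ?_
    · filter_upwards [hnb] with z hz using hx t htpos z hz
    · filter_upwards [hnb] with z hz
      rw [hw0]; exact hnn z hz

lemma aux_f_bound {f : ℝ → ℝ} {θ : ℝ} (hf : CombustionType f θ) :
    ∃ K : ℝ, 0 ≤ K ∧ ∀ v, θ ≤ v → f v ≤ K * (v - θ) := by
  obtain ⟨hc, hθ, hz, h1, -, -, hneg⟩ := hf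
  have hc' : ContDiffOn ℝ 1 f (Icc θ 1) := hc.mono fun x hx => le_trans hθ.1.le hx.1
  obtain ⟨K, hK⟩ := hc'.exists_lipschitzOnWith one_ne_zero (convex_Icc θ 1) isCompact_Icc
  refine ⟨K, K.2, fun v hv => ?_⟩
  have hfθ : f θ = 0 := hz θ ⟨hθ.1.le, le_rfl⟩
  rcases le_or_gt v 1 with h | h
  · have := hK.dist_le_mul v ⟨hv, h⟩ θ ⟨le_rfl, hθ.2.le⟩
    rw [Real.dist_eq, Real.dist_eq, hfθ, sub_zero, abs_of_nonneg (sub_nonneg.2 hv)] at this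
    exact (le_abs_self _).trans this
  · exact (hneg v h).le.trans (mul_nonneg K.2 (by linarith))

section bounds
variable {d δ h₀ θ : ℝ} {f u₀ : ℝ → ℝ} {u : ℝ → ℝ → ℝ} {g h : ℝ → ℝ}

lemma aux_upper (hd : 0 < d)
    (hf : CombustionType f θ) (hδ : δ ∈ Ioc 0 θ)
    (hu₀θ : ∀ x ∈ Icc (-h₀) h₀, u₀ x ≤ θ)
    (hsol : ClassicalSolution d δ h₀ (fun _ _ v => f v) u₀ (Ici (0:ℝ)) u g h) :
    ∀ t, 0 ≤ t → ∀ x ∈ Icc (g t) (h t), u t x ≤ θ := by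
  obtain ⟨K, hK0, hK⟩ := aux_f_bound hf
  have key : ∀ ε > 0, ∀ t, 0 ≤ t → ∀ x ∈ Icc (g t) (h t),
      0 < θ + ε * Real.exp ((K + 1) * t) - u t x := by
    intro ε hε
    refine aux_touching (w := fun t x => θ + ε * Real.exp ((K + 1) * t) - u t x)
      (wt := fun t x => ε * (Real.exp ((K + 1) * t) * (K + 1)) - deriv (fun s => u s x) t)
      (wx := fun t x => - deriv (u t) x) (wxx := fun t x => - deriv (deriv (u t)) x)
      hsol.g_reg.continuousOn hsol.h_reg.continuousOn hsol.g_lt_h ?_ ?_ ?_ ?_ ?_ ?_ ?_ ?_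
    · refine ContinuousOn.sub ?_ hsol.u_cont
      exact Continuous.continuousOn (by fun_prop)
    · intro x hx
      rw [hsol.g_init, hsol.h_init] at hx
      have := hu₀θ x hx
      rw [← hsol.u_init x hx] at this
      have := mul_pos hε (Real.exp_pos ((K + 1) * 0))
      linarith
    · intro t ht
      rw [hsol.bc_g t ht.le ht]
      have := mul_pos hε (Real.exp_pos ((K + 1) * t))
      linarith [hδ.2]
    · intro t ht
      rw [hsol.bc_h t ht.le ht]
      have := mul_pos hε (Real.exp_pos ((K + 1) * t))
      linarith [hδ.2]
    · intro t ht x hx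
      have h1 := (hsol.ut_diff t ht.le ht x hx).hasDerivAt
      have h2 : HasDerivAt (fun s : ℝ => (K + 1) * s) (K + 1) t := by
        simpa using (hasDerivAt_id t).const_mul (K + 1)
      exact ((h2.exp.const_mul ε).const_add θ).sub h1
    · intro t ht x hx
      have h1 := (hsol.ux_diff t ht.le ht x ⟨hx.1.le, hx.2.le⟩).hasDerivAt
      exact h1.const_sub _
    · intro t ht x hx
      exact (hsol.uxx_diff t ht.le ht x hx).hasDerivAt.neg
    · intro t ht x hx hw hwt hwxx
      have hp := hsol.pde t ht.le ht x hx
      have hpos := mul_pos hε (Real.exp_pos ((K + 1) * t))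
      have hfu := hK (u t x) (by linarith)
      have : d * deriv (deriv (u t)) x ≤ 0 := mul_nonpos_of_nonneg_of_nonpos hd.le (by linarith)
      have hq : u t x - θ = ε * Real.exp ((K + 1) * t) := by linarith
      rw [hq] at hfu
      nlinarith
  intro t ht x hx
  by_contra hcon
  push Not at hcon
  have hE := Real.exp_pos ((K + 1) * t)
  have := key ((u t x - θ) / Real.exp ((K + 1) * t)) (div_pos (by linarith) hE) t ht x hx
  rw [div_mul_cancel₀ _ hE.ne'] at this
  linarith

lemma aux_lower {m : ℝ} (hd : 0 < d)
    (hf : CombustionType f θ) (hδ : δ ∈ Ioc 0 θ) (hm : 0 < m)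
    (hmu : ∀ x ∈ Icc (-h₀) h₀, m ≤ u₀ x) (hmδ : m ≤ δ)
    (hsol : ClassicalSolution d δ h₀ (fun _ _ v => f v) u₀ (Ici (0:ℝ)) u g h) :
    ∀ t, 0 ≤ t → ∀ x ∈ Icc (g t) (h t), m ≤ u t x := by
  have key : ∀ ε > 0, ε < m / 2 → ∀ t, 0 ≤ t → ∀ x ∈ Icc (g t) (h t),
      0 < u t x + (ε * (2 - Real.exp (-t)) - m) := by
    intro ε hε hεm
    have hexp : ∀ t : ℝ, 0 ≤ t → Real.exp (-t) ≤ 1 := fun t ht => Real.exp_le_one_iff.2 (by linarith)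
    refine aux_touching (w := fun t x => u t x + (ε * (2 - Real.exp (-t)) - m))
      (wt := fun t x => deriv (fun s => u s x) t + ε * (-(Real.exp (-t) * (-1))))
      (wx := fun t x => deriv (u t) x) (wxx := fun t x => deriv (deriv (u t)) x)
      hsol.g_reg.continuousOn hsol.h_reg.continuousOn hsol.g_lt_h ?_ ?_ ?_ ?_ ?_ ?_ ?_ ?_
    · refine ContinuousOn.add hsol.u_cont ?_
      exact Continuous.continuousOn (by fun_prop)
    · intro x hx
      rw [hsol.g_init, hsol.h_init] at hx
      have := hmu x hx
      rw [← hsol.u_init x hx] at this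
      have := hexp 0 le_rfl
      nlinarith
    · intro t ht
      rw [hsol.bc_g t ht.le ht]
      have := hexp t ht.le
      nlinarith
    · intro t ht
      rw [hsol.bc_h t ht.le ht]
      have := hexp t ht.le
      nlinarith
    · intro t ht x hx
      have h1 := (hsol.ut_diff t ht.le ht x hx).hasDerivAt
      have h2 := (hasDerivAt_neg t).exp
      exact h1.add (((h2.const_sub 2).const_mul ε).sub_const m)
    · intro t ht x hx
      have h1 := (hsol.ux_diff t ht.le ht x ⟨hx.1.le, hx.2.le⟩).hasDerivAt
      exact h1.add_const _
    · intro t ht x hx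
      exact (hsol.uxx_diff t ht.le ht x hx).hasDerivAt
    · intro t ht x hx hw hwt hwxx
      have hp := hsol.pde t ht.le ht x hx
      have he := Real.exp_pos (-t)
      have he1 := hexp t ht.le
      have hf0 : f (u t x) = 0 := hf.2.2.1 _ ⟨by nlinarith, by nlinarith [hδ.2]⟩
      simp only [hf0] at hp
      have := mul_pos hε he
      have : 0 ≤ d * deriv (deriv (u t)) x := mul_nonneg hd.le hwxx
      linarith
  intro t ht x hx
  by_contra hcon
  push Not at hcon
  have hε : 0 < min (m / 4) ((m - u t x) / 2) := lt_min (by linarith) (by linarith)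
  have := key _ hε (lt_of_le_of_lt (min_le_left _ _) (by linarith)) t ht x hx
  have he := Real.exp_pos (-t)
  have := min_le_right (m / 4) ((m - u t x) / 2)
  nlinarith

lemma aux_decay {A σ : ℝ} (hd : 0 < d) (hσ : σ = 1 ∨ σ = -1)
    (hθ1 : θ < 1) (hδ : δ ∈ Ioc 0 θ)
    (hsol : ClassicalSolution d δ h₀ (fun _ _ v => f v) u₀ (Ici (0:ℝ)) u g h)
    (hu0 : ∀ t, 0 ≤ t → ∀ x ∈ Icc (g t) (h t), 0 < u t x ∧ u t x ≤ θ)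
    (hpde : ∀ t, 0 < t → ∀ x ∈ Ioo (g t) (h t),
      deriv (fun s => u s x) t = d * deriv (deriv (u t)) x)
    (hA : ∀ t, 0 ≤ t → ∀ x ∈ Icc (g t) (h t), 1 + x ^ 2 ≤ A) :
    ∀ t, 0 ≤ t → ∀ x ∈ Icc (g t) (h t),
      0 < Real.exp (-(d / A) * t) * (A - x ^ 2) + σ * (u t x - δ) := by
  have hApos : 0 < A := by
    have := hA 0 le_rfl (g 0) ⟨le_rfl, (hsol.g_lt_h 0 (mem_Ici.2 le_rfl)).le⟩
    nlinarith [sq_nonneg (g 0)]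
  have hbd : ∀ t, 0 < t → ∀ x ∈ Icc (g t) (h t), u t x = δ →
      0 < Real.exp (-(d / A) * t) * (A - x ^ 2) + σ * (u t x - δ) := by
    intro t ht x hx he
    rw [he]
    have := mul_pos (Real.exp_pos (-(d / A) * t)) (show 0 < A - x ^ 2 by linarith [hA t ht.le x hx])
    linarith
  refine aux_touching
      (w := fun t x => Real.exp (-(d / A) * t) * (A - x ^ 2) + σ * (u t x - δ))
      (wt := fun t x => Real.exp (-(d / A) * t) * (-(d / A)) * (A - x ^ 2)
        + σ * deriv (fun s => u s x) t)
      (wx := fun t x => Real.exp (-(d / A) * t) * (-(2 * x)) + σ * deriv (u t) x)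
      (wxx := fun t x => Real.exp (-(d / A) * t) * (-2) + σ * deriv (deriv (u t)) x)
      hsol.g_reg.continuousOn hsol.h_reg.continuousOn hsol.g_lt_h ?_ ?_ ?_ ?_ ?_ ?_ ?_ ?_
  · refine ContinuousOn.add (Continuous.continuousOn (by fun_prop)) ?_
    exact continuousOn_const.mul (hsol.u_cont.sub continuousOn_const)
  · intro x hx
    have h1 := hA 0 le_rfl x hx
    have h2 := hu0 0 le_rfl x hx
    have h3 := hδ.1
    have h4 := hδ.2
    simp only [mul_zero, Real.exp_zero, one_mul]
    rcases hσ with rfl | rfl <;> linarith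
  · intro t ht
    exact hbd t ht _ ⟨le_rfl, (hsol.g_lt_h t ht.le).le⟩ (hsol.bc_g t ht.le ht)
  · intro t ht
    exact hbd t ht _ ⟨(hsol.g_lt_h t ht.le).le, le_rfl⟩ (hsol.bc_h t ht.le ht)
  · intro t ht x hx
    have h1 := (hsol.ut_diff t ht.le ht x hx).hasDerivAt
    have h2 : HasDerivAt (fun s : ℝ => -(d / A) * s) (-(d / A)) t := by
      simpa using (hasDerivAt_id t).const_mul (-(d / A))
    exact (h2.exp.mul_const _).add ((h1.sub_const δ).const_mul σ)
  · intro t ht x hx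
    have h1 := (hsol.ux_diff t ht.le ht x ⟨hx.1.le, hx.2.le⟩).hasDerivAt
    have h2 : HasDerivAt (fun y : ℝ => A - y ^ 2) (-(2 * x)) x := by
      simpa using (hasDerivAt_pow 2 x).const_sub A
    exact (h2.const_mul _).add ((h1.sub_const δ).const_mul σ)
  · intro t ht x hx
    have h1 := (hsol.uxx_diff t ht.le ht x hx).hasDerivAt
    have h2 : HasDerivAt (fun y : ℝ => -(2 * y)) (-2) x := by
      have h3 := ((hasDerivAt_id x).const_mul 2).neg
      simp only [id, mul_one] at h3
      exact h3
    exact (h2.const_mul _).add (h1.const_mul σ)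
  · intro t ht x hx hw hwt hwxx
    rw [hpde t ht x hx] at hwt
    have he := Real.exp_pos (-(d / A) * t)
    have h1 : d / A * (A - x ^ 2) ≤ d := by
      rw [div_mul_eq_mul_div, div_le_iff₀ hApos]
      nlinarith [mul_nonneg hd.le (sq_nonneg x)]
    have h2 := mul_nonneg hd.le hwxx
    have h3 := mul_pos he hd
    have h4 := mul_le_mul_of_nonneg_left h1 he.le
    nlinarith

end bounds

lemma aux_leibniz {Ω : Set (ℝ × ℝ)} (hΩ : IsOpen Ω) {p pt : ℝ → ℝ → ℝ}
    (hp : ContinuousOn (fun z : ℝ × ℝ => p z.1 z.2) Ω)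
    (hpt : ContinuousOn (fun z : ℝ × ℝ => pt z.1 z.2) Ω)
    (hder : ∀ t x, (t, x) ∈ Ω → HasDerivAt (fun s => p s x) (pt t x) t)
    {t a b' : ℝ} {b : ℝ → ℝ} (hb : HasDerivAt b b' t)
    (hseg : ∀ y ∈ uIcc a (b t), (t, y) ∈ Ω) :
    HasDerivAt (fun s => ∫ y in a..b s, p s y)
      ((∫ y in a..b t, pt t y) + p t (b t) * b') t ∧
    ∀ᶠ s in nhds t, IntervalIntegrable (p s) MeasureTheory.volume a (b s) := by
  obtain ⟨U, V, hU, hV, htU, hsV, hUV⟩ := generalized_tube_lemma (isCompact_singleton (x := t))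
    (isCompact_uIcc (a := a) (b := b t)) hΩ (by
      rintro ⟨s, y⟩ ⟨hs, hy⟩
      rw [mem_singleton_iff] at hs
      simp only at hs hy
      rw [hs]; exact hseg y hy)
  have htU' : t ∈ U := htU rfl
  obtain ⟨r, hr, hrU⟩ := Metric.nhds_basis_closedBall.mem_iff.1 (hU.mem_nhds htU')
  have hslice : ∀ s ∈ U, ContinuousOn (p s) V := fun s hs =>
    hp.comp (f := fun y => (s, y)) (by fun_prop) fun y hy => hUV ⟨hs, hy⟩
  have hslice' : ∀ s ∈ U, ContinuousOn (pt s) V := fun s hs =>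
    hpt.comp (f := fun y => (s, y)) (by fun_prop) fun y hy => hUV ⟨hs, hy⟩
  have hK : IsCompact (Metric.closedBall t r ×ˢ uIcc a (b t)) :=
    (isCompact_closedBall t r).prod isCompact_uIcc
  have hKΩ : Metric.closedBall t r ×ˢ uIcc a (b t) ⊆ Ω :=
    (prod_mono hrU hsV).trans hUV
  obtain ⟨C, hC⟩ := hK.exists_bound_of_continuousOn (hpt.mono hKΩ)
  have hball : Metric.ball t r ∈ nhds t := Metric.ball_mem_nhds t hr
  have part1 : HasDerivAt (fun s => ∫ y in a..b t, p s y) (∫ y in a..b t, pt t y) t := by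
    refine (intervalIntegral.hasDerivAt_integral_of_dominated_loc_of_deriv_le
      (F := p) (F' := pt) (bound := fun _ => C) hball ?_ ?_ ?_ ?_ ?_ ?_).2
    · filter_upwards [hU.mem_nhds htU'] with s hs
      exact (((hslice s hs).mono hsV).mono uIoc_subset_uIcc).aestronglyMeasurable
        measurableSet_uIoc
    · exact ((hslice t htU').mono hsV).intervalIntegrable
    · exact (((hslice' t htU').mono hsV).mono uIoc_subset_uIcc).aestronglyMeasurable
        measurableSet_uIoc
    · refine Eventually.of_forall fun y hy s hs => ?_
      exact hC (s, y) ⟨Metric.ball_subset_closedBall hs, uIoc_subset_uIcc hy⟩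
    · exact intervalIntegrable_const
    · refine Eventually.of_forall fun y hy s hs => ?_
      exact hder s y (hKΩ ⟨Metric.ball_subset_closedBall hs, uIoc_subset_uIcc hy⟩)
  have hbtV : b t ∈ V := hsV right_mem_uIcc
  have hbc : ContinuousAt b t := hb.continuousAt
  obtain ⟨ρ, hρ, hρV⟩ := Metric.nhds_basis_ball.mem_iff.1 (hV.mem_nhds hbtV)
  have hevseg : ∀ {ρ'}, 0 < ρ' → ∀ᶠ s in nhds t, uIcc (b t) (b s) ⊆ Metric.ball (b t) ρ' := by
    intro ρ' hρ'
    filter_upwards [hbc.eventually (Metric.ball_mem_nhds (b t) hρ')] with s hs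
    have hs : b s ∈ Metric.ball (b t) ρ' := hs
    rw [Real.ball_eq_Ioo] at *
    exact (ordConnected_Ioo).uIcc_subset ⟨by linarith, by linarith⟩ hs
  have part2 : HasDerivAt (fun s => ∫ y in b t..b s, p s y) (p t (b t) * b') t := by
    have hO : (fun s => b s - b t) =O[nhds t] fun s => s - t := hb.isBigO_sub
    have ho1 : (fun s => ∫ y in b t..b s, (p s y - p t (b t))) =o[nhds t] fun s => b s - b t := by
      rw [Asymptotics.isLittleO_iff]
      intro c hc
      have hcont : ContinuousAt (fun z : ℝ × ℝ => p z.1 z.2) (t, b t) :=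
        hp.continuousAt (hΩ.mem_nhds (hseg _ right_mem_uIcc))
      obtain ⟨ρ', hρ', hclose⟩ := Metric.continuousAt_iff.1 hcont c hc
      filter_upwards [hevseg hρ', Metric.ball_mem_nhds t hρ'] with s h1 h2
      refine intervalIntegral.norm_integral_le_of_norm_le_const fun y hy => ?_
      have h3 := h1 (uIoc_subset_uIcc hy)
      have := @hclose (s, y) (by
        rw [Prod.dist_eq]; exact max_lt h2 h3)
      rw [Real.dist_eq] at this
      exact this.le
    have ho2 := ho1.trans_isBigO hO
    have ho3 : (fun s => p t (b t) * (b s - b t - (s - t) • b')) =o[nhds t] fun s => s - t :=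
      (hasDerivAt_iff_isLittleO.1 hb).const_mul_left _
    rw [hasDerivAt_iff_isLittleO]
    refine (ho2.add ho3).congr' ?_ EventuallyEq.rfl
    filter_upwards [hevseg hρ, hU.mem_nhds htU'] with s h1 h2
    rw [intervalIntegral.integral_sub (((hslice s h2).mono (h1.trans hρV)).intervalIntegrable)
      intervalIntegrable_const]
    simp only [intervalIntegral.integral_const, smul_eq_mul, intervalIntegral.integral_same]
    ring
  have hii : ∀ᶠ s in nhds t, IntervalIntegrable (p s) MeasureTheory.volume a (b t) ∧
      IntervalIntegrable (p s) MeasureTheory.volume (b t) (b s) := by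
    filter_upwards [hevseg hρ, hU.mem_nhds htU'] with s h1 h2
    exact ⟨((hslice s h2).mono hsV).intervalIntegrable,
      ((hslice s h2).mono (h1.trans hρV)).intervalIntegrable⟩
  refine ⟨(part1.add part2).congr_of_eventuallyEq ?_, hii.mono fun s hs => hs.1.trans hs.2⟩
  filter_upwards [hii] with s hs
  exact (intervalIntegral.integral_add_adjacent_intervals hs.1 hs.2).symm

section conservation
variable {d δ h₀ : ℝ} {f u₀ : ℝ → ℝ} {u : ℝ → ℝ → ℝ} {g h : ℝ → ℝ}

lemma aux_Omega_open (hsol : ClassicalSolution d δ h₀ (fun _ _ v => f v) u₀ (Ici (0:ℝ)) u g h) :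
    IsOpen {p : ℝ × ℝ | p.1 ∈ Ici (0:ℝ) ∧ 0 < p.1 ∧ p.2 ∈ Ioo (g p.1) (h p.1)} := by
  have hO : IsOpen {p : ℝ × ℝ | 0 < p.1} := isOpen_lt continuous_const continuous_fst
  have hg : ContinuousOn (fun p : ℝ × ℝ => p.2 - g p.1) {p : ℝ × ℝ | 0 < p.1} :=
    continuousOn_snd.sub (hsol.g_reg.continuousOn.comp continuousOn_fst fun p hp => mem_Ici.2 (le_of_lt hp))
  have hh : ContinuousOn (fun p : ℝ × ℝ => h p.1 - p.2) {p : ℝ × ℝ | 0 < p.1} :=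
    (hsol.h_reg.continuousOn.comp continuousOn_fst fun p hp => mem_Ici.2 (le_of_lt hp)).sub continuousOn_snd
  have h1 := hg.isOpen_inter_preimage hO (isOpen_Ioi (a := (0:ℝ)))
  have h2 := hh.isOpen_inter_preimage hO (isOpen_Ioi (a := (0:ℝ)))
  convert h1.inter h2 using 1
  ext ⟨t, x⟩
  simp only [Set.mem_ofPred_eq, mem_inter_iff, mem_preimage, mem_Ioi, mem_Ioo, sub_pos, mem_Ici]
  constructor
  · rintro ⟨-, h1, h2, h3⟩; exact ⟨⟨h1, h2⟩, h1, h3⟩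
  · rintro ⟨⟨h1, h2⟩, -, h3⟩; exact ⟨h1.le, h1, h2, h3⟩

/-- the flux functional at the relative position `κ`. -/
noncomputable def auxB (d α β : ℝ) (u : ℝ → ℝ → ℝ) (g h : ℝ → ℝ) (t κ : ℝ) : ℝ :=
  u t (g t + κ * (h t - g t)) * (α + β * (g t + κ * (h t - g t)))
      * (deriv g t + κ * (deriv h t - deriv g t))
    + d * (deriv (u t) (g t + κ * (h t - g t)) * (α + β * (g t + κ * (h t - g t)))
      - u t (g t + κ * (h t - g t)) * β)

lemma aux_pos_mem {a b κ : ℝ} (hab : a < b) (hκ : κ ∈ Icc (0:ℝ) 1) :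
    a + κ * (b - a) ∈ Icc a b := by
  obtain ⟨h1, h2⟩ := hκ
  constructor <;> nlinarith

lemma aux_pos_mem' {a b κ : ℝ} (hab : a < b) (hκ : κ ∈ Ioo (0:ℝ) 1) :
    a + κ * (b - a) ∈ Ioo a b := by
  obtain ⟨h1, h2⟩ := hκ
  constructor <;> nlinarith

lemma aux_B_end (hδ : 0 < δ)
    (hsol : ClassicalSolution d δ h₀ (fun _ _ v => f v) u₀ (Ici (0:ℝ)) u g h)
    (α β : ℝ) {t : ℝ} (ht : 0 < t) :
    auxB d α β u g h t 0 = - (d * δ * β) ∧ auxB d α β u g h t 1 = - (d * δ * β) := by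
  have e1 : g t + 1 * (h t - g t) = h t := by ring
  constructor
  · simp only [auxB, zero_mul, add_zero, hsol.bc_g t ht.le ht, hsol.stefan_g t ht.le ht]
    field_simp
    ring
  · simp only [auxB, e1, hsol.bc_h t ht.le ht, hsol.stefan_h t ht.le ht]
    field_simp
    ring

lemma aux_B_cont
    (hsol : ClassicalSolution d δ h₀ (fun _ _ v => f v) u₀ (Ici (0:ℝ)) u g h) (α β : ℝ) :
    ContinuousOn (fun p : ℝ × ℝ => auxB d α β u g h p.1 p.2) (Ioi (0:ℝ) ×ˢ Icc (0:ℝ) 1) := by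
  have hsub : Ioi (0:ℝ) ⊆ Ici 0 := Ioi_subset_Ici_self
  have hg : ContinuousOn (fun p : ℝ × ℝ => g p.1) (Ioi (0:ℝ) ×ˢ Icc (0:ℝ) 1) :=
    hsol.g_reg.continuousOn.comp continuousOn_fst (fun p hp => hsub hp.1)
  have hh : ContinuousOn (fun p : ℝ × ℝ => h p.1) (Ioi (0:ℝ) ×ˢ Icc (0:ℝ) 1) :=
    hsol.h_reg.continuousOn.comp continuousOn_fst (fun p hp => hsub hp.1)
  have hg' : ContinuousOn (fun p : ℝ × ℝ => deriv g p.1) (Ioi (0:ℝ) ×ˢ Icc (0:ℝ) 1) :=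
    ((hsol.g_reg.mono hsub).continuousOn_deriv_of_isOpen isOpen_Ioi le_rfl).comp continuousOn_fst
      (fun p hp => hp.1)
  have hh' : ContinuousOn (fun p : ℝ × ℝ => deriv h p.1) (Ioi (0:ℝ) ×ˢ Icc (0:ℝ) 1) :=
    ((hsol.h_reg.mono hsub).continuousOn_deriv_of_isOpen isOpen_Ioi le_rfl).comp continuousOn_fst
      (fun p hp => hp.1)
  have hX : ContinuousOn (fun p : ℝ × ℝ => g p.1 + p.2 * (h p.1 - g p.1))
      (Ioi (0:ℝ) ×ˢ Icc (0:ℝ) 1) := hg.add (continuousOn_snd.mul (hh.sub hg))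
  have hm := (continuousOn_fst (s := Ioi (0:ℝ) ×ˢ Icc (0:ℝ) 1)).prodMk hX
  have hu : ContinuousOn (fun p : ℝ × ℝ => u p.1 (g p.1 + p.2 * (h p.1 - g p.1)))
      (Ioi (0:ℝ) ×ˢ Icc (0:ℝ) 1) :=
    hsol.u_cont.comp hm fun p hp =>
      ⟨hsub hp.1, aux_pos_mem (hsol.g_lt_h _ (hsub hp.1)) hp.2⟩
  have hux : ContinuousOn (fun p : ℝ × ℝ => deriv (u p.1) (g p.1 + p.2 * (h p.1 - g p.1)))
      (Ioi (0:ℝ) ×ˢ Icc (0:ℝ) 1) :=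
    hsol.ux_cont.comp hm fun p hp =>
      ⟨hsub hp.1, hp.1, aux_pos_mem (hsol.g_lt_h _ (hsub hp.1)) hp.2⟩
  have hq : ContinuousOn (fun p : ℝ × ℝ => α + β * (g p.1 + p.2 * (h p.1 - g p.1)))
      (Ioi (0:ℝ) ×ˢ Icc (0:ℝ) 1) := continuousOn_const.add (continuousOn_const.mul hX)
  have hX' : ContinuousOn (fun p : ℝ × ℝ => deriv g p.1 + p.2 * (deriv h p.1 - deriv g p.1))
      (Ioi (0:ℝ) ×ˢ Icc (0:ℝ) 1) := hg'.add (continuousOn_snd.mul (hh'.sub hg'))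
  exact ((hu.mul hq).mul hX').add
    (continuousOn_const.mul ((hux.mul hq).sub (hu.mul continuousOn_const)))

lemma aux_J_deriv
    (hsol : ClassicalSolution d δ h₀ (fun _ _ v => f v) u₀ (Ici (0:ℝ)) u g h)
    (hpde : ∀ t, 0 < t → ∀ x ∈ Ioo (g t) (h t),
      deriv (fun s => u s x) t = d * deriv (deriv (u t)) x)
    (α β : ℝ) {t κ : ℝ} (ht : 0 < t) (hκ : κ ∈ Ioo (0:ℝ) 1) :
    HasDerivAt (fun s => ∫ x in (g s + κ * (h s - g s))..(g s + (1 - κ) * (h s - g s)),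
      u s x * (α + β * x)) (auxB d α β u g h t (1 - κ) - auxB d α β u g h t κ) t := by
  set a := g t + (1 / 2) * (h t - g t) with ha
  have hlt := hsol.g_lt_h t ht.le
  have haI : a ∈ Ioo (g t) (h t) := aux_pos_mem' hlt ⟨by norm_num, by norm_num⟩
  have hgd : HasDerivAt g (deriv g t) t :=
    ((hsol.g_reg.differentiableOn one_ne_zero).differentiableAt (Ici_mem_nhds ht)).hasDerivAt
  have hhd : HasDerivAt h (deriv h t) t :=
    ((hsol.h_reg.differentiableOn one_ne_zero).differentiableAt (Ici_mem_nhds ht)).hasDerivAt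
  have hΩ := aux_Omega_open hsol
  have hsegm : ∀ k ∈ Ioo (0:ℝ) 1, uIcc a (g t + k * (h t - g t)) ⊆ Ioo (g t) (h t) :=
    fun k hk => ordConnected_Ioo.uIcc_subset haI (aux_pos_mem' hlt hk)
  have key : ∀ k ∈ Ioo (0:ℝ) 1,
      HasDerivAt (fun s => ∫ x in a..(g s + k * (h s - g s)), u s x * (α + β * x))
        (auxB d α β u g h t k - d * (deriv (u t) a * (α + β * a) - u t a * β)) t ∧
      ∀ᶠ s in nhds t, IntervalIntegrable (fun x => u s x * (α + β * x))
        MeasureTheory.volume a (g s + k * (h s - g s)) := by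
    intro k hk
    have hb : HasDerivAt (fun s => g s + k * (h s - g s))
        (deriv g t + k * (deriv h t - deriv g t)) t := hgd.add ((hhd.sub hgd).const_mul k)
    have hL := aux_leibniz hΩ (p := fun s x => u s x * (α + β * x))
      (pt := fun s x => deriv (fun s => u s x) s * (α + β * x)) (a := a)
      (ContinuousOn.mul (hsol.u_cont.mono fun p hp => ⟨hp.1, hp.2.2.1.le, hp.2.2.2.le⟩)
        (Continuous.continuousOn (by fun_prop)))
      (ContinuousOn.mul hsol.ut_cont (Continuous.continuousOn (by fun_prop)))
      (fun t x htx => (hsol.ut_diff t htx.1 htx.2.1 x htx.2.2).hasDerivAt.mul_const _)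
      hb (fun y hy => ⟨ht.le, ht, hsegm k hk hy⟩)
    refine ⟨hL.1.congr_deriv ?_, hL.2⟩
    have hint : (∫ y in a..(g t + k * (h t - g t)), deriv (fun s => u s y) t * (α + β * y))
        = d * (deriv (u t) (g t + k * (h t - g t)) * (α + β * (g t + k * (h t - g t)))
            - u t (g t + k * (h t - g t)) * β)
          - d * (deriv (u t) a * (α + β * a) - u t a * β) := by
      refine intervalIntegral.integral_eq_sub_of_hasDerivAt
        (f := fun y => d * (deriv (u t) y * (α + β * y) - u t y * β)) ?_ ?_
      · intro y hy
        have hy' := hsegm k hk hy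
        have h1 := (hsol.ux_diff t ht.le ht y ⟨hy'.1.le, hy'.2.le⟩).hasDerivAt
        have h2 := (hsol.uxx_diff t ht.le ht y hy').hasDerivAt
        have h3 : HasDerivAt (fun y : ℝ => α + β * y) β y := by
          simpa using ((hasDerivAt_id y).const_mul β).const_add α
        refine (((h2.mul h3).sub (h1.mul_const β)).const_mul d).congr_deriv ?_
        rw [hpde t ht y hy']
        ring
      · refine ContinuousOn.intervalIntegrable ?_
        refine ContinuousOn.mul ?_ (Continuous.continuousOn (by fun_prop))
        exact hsol.ut_cont.comp (f := fun y => (t, y)) (by fun_prop)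
          fun y hy => ⟨ht.le, ht, hsegm k hk hy⟩
    rw [hint, auxB]
    ring
  have k1 := key κ hκ
  have k2 := key (1 - κ) ⟨by linarith [hκ.2], by linarith [hκ.1]⟩
  refine ((k2.1.sub k1.1).congr_deriv (by ring)).congr_of_eventuallyEq ?_
  filter_upwards [k1.2, k2.2] with s i1 i2
  exact (intervalIntegral.integral_interval_sub_left i2 i1).symm

lemma aux_slice_cont
    (hsol : ClassicalSolution d δ h₀ (fun _ _ v => f v) u₀ (Ici (0:ℝ)) u g h)
    {t : ℝ} (ht : 0 ≤ t) : ContinuousOn (u t) (Icc (g t) (h t)) :=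
  hsol.u_cont.comp (f := fun y => (t, y)) (by fun_prop) fun y hy => ⟨ht, hy⟩

lemma aux_J_lim
    (hsol : ClassicalSolution d δ h₀ (fun _ _ v => f v) u₀ (Ici (0:ℝ)) u g h)
    (α β : ℝ) {t : ℝ} (ht : 0 < t) :
    Tendsto (fun κ => ∫ x in (g t + κ * (h t - g t))..(g t + (1 - κ) * (h t - g t)),
      u t x * (α + β * x)) (nhdsWithin 0 (Ioi 0))
      (nhds (∫ x in (g t)..(h t), u t x * (α + β * x))) := by
  have hlt := hsol.g_lt_h t ht.le
  have hc : ContinuousOn (fun x => u t x * (α + β * x)) (Icc (g t) (h t)) :=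
    (aux_slice_cont hsol ht.le).mul (Continuous.continuousOn (by fun_prop))
  have hc' : ContinuousOn (fun x => u t x * (α + β * x)) (uIcc (g t) (h t)) := by
    rwa [uIcc_of_le hlt.le]
  have hF := intervalIntegral.continuousOn_primitive_interval'
    (hc'.intervalIntegrable (μ := MeasureTheory.volume)) (left_mem_uIcc)
  rw [uIcc_of_le hlt.le] at hF
  have hG1 : ContinuousOn (fun κ : ℝ => ∫ x in (g t)..(g t + κ * (h t - g t)),
      u t x * (α + β * x)) (Icc 0 1) :=
    hF.comp (f := fun κ => g t + κ * (h t - g t)) (Continuous.continuousOn (by fun_prop))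
      fun κ hκ => aux_pos_mem hlt hκ
  have hG2 : ContinuousOn (fun κ : ℝ => ∫ x in (g t)..(g t + (1 - κ) * (h t - g t)),
      u t x * (α + β * x)) (Icc 0 1) :=
    hF.comp (f := fun κ => g t + (1 - κ) * (h t - g t)) (Continuous.continuousOn (by fun_prop))
      fun κ hκ => aux_pos_mem hlt ⟨by linarith [hκ.2], by linarith [hκ.1]⟩
  have hT := ((hG2.sub hG1) 0 ⟨le_rfl, zero_le_one⟩).tendsto
  simp only [Pi.sub_apply, sub_zero, one_mul, zero_mul, add_zero, intervalIntegral.integral_same,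
    add_sub_cancel] at hT
  have hIoo : Ioo (0:ℝ) 1 ∈ nhdsWithin (0:ℝ) (Ioi 0) := Ioo_mem_nhdsGT one_pos
  have hle : nhdsWithin (0:ℝ) (Ioi 0) ≤ nhdsWithin 0 (Icc 0 1) :=
    nhdsWithin_le_of_mem (mem_of_superset hIoo Ioo_subset_Icc_self)
  refine (hT.mono_left hle).congr' ?_
  filter_upwards [hIoo] with κ hκ
  have ii : ∀ k ∈ Icc (0:ℝ) 1, IntervalIntegrable (fun x => u t x * (α + β * x))
      MeasureTheory.volume (g t) (g t + k * (h t - g t)) := fun k hk =>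
    (hc.mono (ordConnected_Icc.uIcc_subset ⟨le_rfl, hlt.le⟩ (aux_pos_mem hlt hk))).intervalIntegrable
  exact intervalIntegral.integral_interval_sub_left (ii (1 - κ) ⟨by linarith [hκ.2], by linarith [hκ.1]⟩)
    (ii κ ⟨hκ.1.le, hκ.2.le⟩)

lemma aux_J_const_pos (hδ : 0 < δ)
    (hsol : ClassicalSolution d δ h₀ (fun _ _ v => f v) u₀ (Ici (0:ℝ)) u g h)
    (hpde : ∀ t, 0 < t → ∀ x ∈ Ioo (g t) (h t),
      deriv (fun s => u s x) t = d * deriv (deriv (u t)) x)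
    (α β : ℝ) {s t : ℝ} (hs : 0 < s) (hst : s ≤ t) :
    (∫ x in (g t)..(h t), u t x * (α + β * x)) = ∫ x in (g s)..(h s), u s x * (α + β * x) := by
  have ht : 0 < t := hs.trans_le hst
  -- uniform smallness of the flux difference
  have hR : ContinuousOn (fun p : ℝ × ℝ => auxB d α β u g h p.1 (1 - p.2)
      - auxB d α β u g h p.1 p.2) (Icc s t ×ˢ Icc (0:ℝ) 1) := by
    have hB := aux_B_cont hsol α β
    refine ContinuousOn.sub ?_ ?_
    · refine hB.comp (f := fun p : ℝ × ℝ => (p.1, 1 - p.2))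
        (Continuous.continuousOn (by fun_prop)) fun p hp => ⟨hs.trans_le hp.1.1, ?_⟩
      exact ⟨by linarith [hp.2.2], by linarith [hp.2.1]⟩
    · exact hB.mono fun p hp => ⟨hs.trans_le hp.1.1, hp.2⟩
  have hUC := (isCompact_Icc.prod isCompact_Icc).uniformContinuousOn_of_continuous hR
  rw [Metric.uniformContinuousOn_iff] at hUC
  have hbound : ∀ ε > 0, |(∫ x in (g t)..(h t), u t x * (α + β * x))
      - ∫ x in (g s)..(h s), u s x * (α + β * x)| ≤ ε * (t - s) := by
    intro ε hε
    obtain ⟨ρ, hρ, hclose⟩ := hUC ε hε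
    have hlim := ((aux_J_lim hsol α β ht).sub (aux_J_lim hsol α β hs)).abs
    refine le_of_tendsto hlim ?_
    filter_upwards [Ioo_mem_nhdsGT (one_pos (α := ℝ)), Ioo_mem_nhdsGT hρ] with κ hκ hκρ
    have := norm_image_sub_le_of_norm_deriv_le_segment' (a := s) (b := t) (C := ε)
      (f := fun s => ∫ x in (g s + κ * (h s - g s))..(g s + (1 - κ) * (h s - g s)),
        u s x * (α + β * x))
      (f' := fun τ => auxB d α β u g h τ (1 - κ) - auxB d α β u g h τ κ)
      (fun τ hτ => (aux_J_deriv hsol hpde α β (hs.trans_le hτ.1) hκ).hasDerivWithinAt)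
      (fun τ hτ => by
        have hτ' : τ ∈ Icc s t := ⟨hτ.1, hτ.2.le⟩
        have h1 := hclose (τ, κ) ⟨hτ', hκ.1.le, hκ.2.le⟩ (τ, 0) ⟨hτ', le_rfl, zero_le_one⟩ (by
          rw [Prod.dist_eq]
          simp only [dist_self, Real.dist_eq, sub_zero, abs_of_pos hκ.1]
          exact max_lt hρ hκρ.2)
        have h2 := aux_B_end hδ hsol α β (hs.trans_le hτ.1)
        simp only [sub_zero, h2.1, h2.2, sub_self, Real.dist_eq] at h1
        exact h1.le) t ⟨hst, le_rfl⟩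
    exact this
  by_contra hne
  have hpos : 0 < |(∫ x in (g t)..(h t), u t x * (α + β * x))
      - ∫ x in (g s)..(h s), u s x * (α + β * x)| := abs_pos.2 (sub_ne_zero.2 hne)
  have h2 : 0 < 2 * (t - s + 1) := by linarith
  have := hbound (|(∫ x in (g t)..(h t), u t x * (α + β * x))
      - ∫ x in (g s)..(h s), u s x * (α + β * x)| / (2 * (t - s + 1))) (div_pos hpos h2)
  rw [div_mul_eq_mul_div, le_div_iff₀ h2] at this
  nlinarith

lemma aux_J_cont
    (hsol : ClassicalSolution d δ h₀ (fun _ _ v => f v) u₀ (Ici (0:ℝ)) u g h) (α β : ℝ) :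
    Tendsto (fun t => ∫ x in (g t)..(h t), u t x * (α + β * x)) (nhdsWithin 0 (Ioi 0))
      (nhds (∫ x in (g 0)..(h 0), u 0 x * (α + β * x))) := by
  have hw : ContinuousOn (fun p : ℝ × ℝ => u p.1 p.2 * (α + β * p.2))
      {p : ℝ × ℝ | p.1 ∈ Ici (0:ℝ) ∧ p.2 ∈ Icc (g p.1) (h p.1)} :=
    hsol.u_cont.mul (Continuous.continuousOn (by fun_prop))
  have hW := aux_straight_cont (w := fun t x => u t x * (α + β * x)) hsol.g_reg.continuousOn
    hsol.h_reg.continuousOn hsol.g_lt_h hw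
  have hm : Continuous fun p : ℝ × ℝ => (max p.1 0, max 0 (min p.2 1)) := by fun_prop
  have hZ := hW.comp_continuous hm (fun p => ⟨mem_Ici.2 (le_max_right _ _), mem_Icc.2 ⟨le_max_left _ _,
    max_le zero_le_one (min_le_right _ _)⟩⟩)
  have hI := intervalIntegral.continuous_parametric_intervalIntegral_of_continuous'
    (μ := MeasureTheory.volume)
    (f := fun (t y : ℝ) => u (max t 0) (g (max t 0) + max 0 (min y 1) * (h (max t 0) - g (max t 0)))
      * (α + β * (g (max t 0) + max 0 (min y 1) * (h (max t 0) - g (max t 0))))) hZ 0 1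
  have hgc : Continuous fun t => g (max t 0) :=
    hsol.g_reg.continuousOn.comp_continuous (by fun_prop) fun t => mem_Ici.2 (le_max_right _ _)
  have hhc : Continuous fun t => h (max t 0) :=
    hsol.h_reg.continuousOn.comp_continuous (by fun_prop) fun t => mem_Ici.2 (le_max_right _ _)
  have hJ := (hhc.sub hgc).mul hI
  have hEq : ∀ t, 0 ≤ t → (h (max t 0) - g (max t 0)) * (∫ y in (0:ℝ)..1,
      u (max t 0) (g (max t 0) + max 0 (min y 1) * (h (max t 0) - g (max t 0)))
      * (α + β * (g (max t 0) + max 0 (min y 1) * (h (max t 0) - g (max t 0)))))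
      = ∫ x in (g t)..(h t), u t x * (α + β * x) := by
    intro t ht
    rw [max_eq_left ht]
    have := intervalIntegral.mul_integral_comp_add_mul (a := 0) (b := 1)
      (f := fun x => u t x * (α + β * x)) (h t - g t) (g t)
    rw [mul_zero, mul_one, add_zero, add_sub_cancel] at this
    rw [← this]
    congr 1
    refine intervalIntegral.integral_congr fun y hy => ?_
    rw [uIcc_of_le zero_le_one] at hy
    simp only [min_eq_left hy.2, max_eq_right hy.1]
    rw [mul_comm y]
  have hT := (hJ.tendsto 0).mono_left (nhdsWithin_le_nhds (s := Ioi 0))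
  simp only [Pi.mul_apply, Pi.sub_apply] at hT
  rw [hEq 0 le_rfl] at hT
  refine hT.congr' ?_
  filter_upwards [self_mem_nhdsWithin] with t ht
  exact hEq t (le_of_lt ht)

lemma aux_J_const (hδ : 0 < δ)
    (hsol : ClassicalSolution d δ h₀ (fun _ _ v => f v) u₀ (Ici (0:ℝ)) u g h)
    (hpde : ∀ t, 0 < t → ∀ x ∈ Ioo (g t) (h t),
      deriv (fun s => u s x) t = d * deriv (deriv (u t)) x)
    (α β : ℝ) {t : ℝ} (ht : 0 < t) :
    (∫ x in (g t)..(h t), u t x * (α + β * x))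
      = ∫ x in (-h₀)..h₀, u₀ x * (α + β * x) := by
  have h1 := aux_J_cont hsol α β
  have h2 : Tendsto (fun s => ∫ x in (g s)..(h s), u s x * (α + β * x)) (nhdsWithin 0 (Ioi 0))
      (nhds (∫ x in (g t)..(h t), u t x * (α + β * x))) := by
    refine tendsto_const_nhds.congr' ?_
    filter_upwards [Ioo_mem_nhdsGT ht] with s hs
    exact aux_J_const_pos hδ hsol hpde α β hs.1 hs.2.le
  rw [tendsto_nhds_unique h2 h1, hsol.g_init, hsol.h_init]
  have hlt := hsol.g_lt_h 0 (mem_Ici.2 le_rfl)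
  rw [hsol.g_init, hsol.h_init] at hlt
  refine intervalIntegral.integral_congr fun x hx => ?_
  rw [uIcc_of_le hlt.le] at hx
  simp only [hsol.u_init x hx]

end conservation

/-- combustion nonlinearity with small boundary density
(Conjecture 4 part (i)). -/
theorem combustion_small_delta (d δ h₀ θ : ℝ) (f u₀ : ℝ → ℝ)
    (u : ℝ → ℝ → ℝ) (g h : ℝ → ℝ)
    (hd : 0 < d) (hh₀ : 0 < h₀)
    (hf : CombustionType f θ) (hδ : δ ∈ Ioc 0 θ)
    (hu₀ : InX δ h₀ u₀) (hu₀θ : ∀ x ∈ Icc (-h₀) h₀, u₀ x ≤ θ)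
    (hsol : ClassicalSolution d δ h₀ (fun _ _ v => f v) u₀ (Ici (0:ℝ)) u g h) :
    (∀ ε > 0, ∃ T > 0, ∀ t ≥ T, ∀ x ∈ Icc (g t) (h t), |u t x - δ| < ε) ∧
    ∃ ginf hinf : ℝ, Tendsto g atTop (nhds ginf) ∧ Tendsto h atTop (nhds hinf) ∧
      δ * (hinf - ginf) = ∫ x in (-h₀)..h₀, u₀ x := by
  have hδ0 : 0 < δ := hδ.1
  obtain ⟨hu₀c, hu₀l, hu₀r, hu₀pos⟩ := hu₀
  have hu₀cont := hu₀c.continuousOn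
  obtain ⟨x0, hx0, hmin⟩ := isCompact_Icc.exists_isMinOn
    (nonempty_Icc.2 (by linarith : -h₀ ≤ h₀)) hu₀cont
  set m := u₀ x0 with hmdef
  have hm : 0 < m := hu₀pos x0 hx0
  have hmu : ∀ x ∈ Icc (-h₀) h₀, m ≤ u₀ x := fun x hx => hmin hx
  have hmδ : m ≤ δ := by
    rw [← hu₀r]; exact hmu h₀ ⟨by linarith, le_rfl⟩
  have hup := aux_upper hd hf hδ hu₀θ hsol
  have hlow := aux_lower hd hf hδ hm hmu hmδ hsol
  have hpde : ∀ t, 0 < t → ∀ x ∈ Ioo (g t) (h t),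
      deriv (fun s => u s x) t = d * deriv (deriv (u t)) x := by
    intro t ht x hx
    have hx' : x ∈ Icc (g t) (h t) := ⟨hx.1.le, hx.2.le⟩
    rw [hsol.pde t ht.le ht x hx,
      hf.2.2.1 _ ⟨hm.le.trans (hlow t ht.le x hx'), hup t ht.le x hx'⟩, add_zero]
  have hcons := fun (α β t : ℝ) (ht : 0 < t) => aux_J_const hδ0 hsol hpde α β ht
  set M := ∫ x in (-h₀)..h₀, u₀ x with hM
  set M1 := ∫ x in (-h₀)..h₀, u₀ x * x with hM1
  have hu₀cont' : ContinuousOn u₀ (uIcc (-h₀) h₀) := by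
    rwa [uIcc_of_le (by linarith : -h₀ ≤ h₀)]
  have hJ : ∀ α β t, 0 < t → (∫ x in (g t)..(h t), u t x * (α + β * x)) = α * M + β * M1 := by
    intro α β t ht
    rw [hcons α β t ht, hM, hM1, ← intervalIntegral.integral_const_mul,
      ← intervalIntegral.integral_const_mul, ← intervalIntegral.integral_add]
    · exact intervalIntegral.integral_congr fun x _ => by ring
    · exact (continuousOn_const.mul hu₀cont').intervalIntegrable
    · exact (continuousOn_const.mul (hu₀cont'.mul continuousOn_id)).intervalIntegrable
  have hlt : ∀ t, 0 ≤ t → g t < h t := fun t ht => hsol.g_lt_h t ht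
  have hii : ∀ α β t, 0 ≤ t → IntervalIntegrable (fun x => u t x * (α + β * x))
      MeasureTheory.volume (g t) (h t) := by
    intro α β t ht
    refine ContinuousOn.intervalIntegrable ?_
    rw [uIcc_of_le (hlt t ht).le]
    exact (aux_slice_cont hsol ht).mul (Continuous.continuousOn (by fun_prop))
  have hlen : ∀ t, 0 < t → m * (h t - g t) ≤ M := by
    intro t ht
    have h1 := hJ 1 0 t ht
    have h2 : (∫ _x in (g t)..(h t), m) ≤ ∫ x in (g t)..(h t), u t x * (1 + 0 * x) :=
      intervalIntegral.integral_mono_on (hlt t ht.le).le intervalIntegrable_const (hii 1 0 t ht.le)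
        fun x hx => by have := hlow t ht.le x hx; linarith
    rw [h1, intervalIntegral.integral_const, smul_eq_mul] at h2
    linarith
  have hMpos : 0 < M := lt_of_lt_of_le (mul_pos hm (sub_pos.2 (hlt 1 zero_le_one))) (hlen 1 one_pos)
  have hnn : ∀ α β t, 0 < t → (∀ x ∈ Icc (g t) (h t), 0 ≤ α + β * x) → 0 ≤ α * M + β * M1 := by
    intro α β t ht hq
    rw [← hJ α β t ht]
    exact intervalIntegral.integral_nonneg (hlt t ht.le).le fun x hx =>
      mul_nonneg (hm.le.trans (hlow t ht.le x hx)) (hq x hx)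
  set c := M1 / M with hc
  have hcM : M1 = c * M := by rw [hc, div_mul_cancel₀ _ hMpos.ne']
  have hgc : ∀ t, 0 < t → g t ≤ c := by
    intro t ht
    have := hnn (-g t) 1 t ht fun x hx => by linarith [hx.1]
    rw [hcM] at this
    by_contra hcon
    push Not at hcon
    nlinarith
  have hhc : ∀ t, 0 < t → c ≤ h t := by
    intro t ht
    have := hnn (h t) (-1) t ht fun x hx => by linarith [hx.2]
    rw [hcM] at this
    by_contra hcon
    push Not at hcon
    nlinarith
  set Lm := M / m with hLm
  have hLmpos : 0 < Lm := div_pos hMpos hm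
  have hlen' : ∀ t, 0 < t → h t - g t ≤ Lm := by
    intro t ht
    rw [hLm, le_div_iff₀ hm]
    linarith [hlen t ht]
  set A := 1 + (|c| + Lm) ^ 2 + h₀ ^ 2 with hAdef
  have hA : ∀ t, 0 ≤ t → ∀ x ∈ Icc (g t) (h t), 1 + x ^ 2 ≤ A := by
    intro t ht x hx
    rcases ht.eq_or_lt with rfl | ht
    · rw [hsol.g_init, hsol.h_init] at hx
      have : x ^ 2 ≤ h₀ ^ 2 := sq_le_sq' hx.1 hx.2
      nlinarith [sq_nonneg (|c| + Lm)]
    · have h1 := hgc t ht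
      have h2 := hhc t ht
      have h3 := hlen' t ht
      have h4 := le_abs_self c
      have h5 := neg_abs_le c
      have : x ^ 2 ≤ (|c| + Lm) ^ 2 := sq_le_sq' (by linarith [hx.1]) (by linarith [hx.2])
      nlinarith [sq_nonneg h₀]
  have hApos : 0 < A := by positivity
  have hu0 : ∀ t, 0 ≤ t → ∀ x ∈ Icc (g t) (h t), 0 < u t x ∧ u t x ≤ θ := fun t ht x hx =>
    ⟨hm.trans_le (hlow t ht x hx), hup t ht x hx⟩
  have hdec : ∀ t, 0 ≤ t → ∀ x ∈ Icc (g t) (h t), |u t x - δ| ≤ Real.exp (-(d / A) * t) * A := by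
    intro t ht x hx
    have h1 := aux_decay hd (Or.inl rfl) hf.2.1.2 hδ hsol hu0 hpde hA t ht x hx
    have h2 := aux_decay hd (Or.inr rfl) hf.2.1.2 hδ hsol hu0 hpde hA t ht x hx
    have h3 := mul_nonneg (Real.exp_pos (-(d / A) * t)).le (sq_nonneg x)
    rw [abs_le]
    constructor <;> nlinarith
  have hexp : Tendsto (fun t => Real.exp (-(d / A) * t)) atTop (nhds 0) := by
    refine Real.tendsto_exp_atBot.comp ?_
    exact tendsto_id.const_mul_atTop_of_neg (neg_neg_of_pos (div_pos hd hApos))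
  have hexpA : Tendsto (fun t => Real.exp (-(d / A) * t) * A) atTop (nhds 0) := by
    simpa using hexp.mul_const A
  refine ⟨?_, ?_⟩
  · intro ε hε
    obtain ⟨T, hT⟩ := eventually_atTop.1 (hexpA.eventually (gt_mem_nhds hε))
    refine ⟨max T 1, lt_max_of_lt_right one_pos, fun t ht x hx => ?_⟩
    have h1 : T ≤ t := (le_max_left _ _).trans ht
    have h2 : (1:ℝ) ≤ t := (le_max_right _ _).trans ht
    exact (hdec t (by linarith) x hx).trans_lt (hT t h1)
  -- convergence of the moments of the limiting interval
  have hmom : ∀ α β : ℝ, (∀ t, 0 ≤ t → ∀ x ∈ Icc (g t) (h t), |α + β * x| ≤ A) →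
      Tendsto (fun t => δ * (α * (h t - g t) + β * ((h t ^ 2 - g t ^ 2) / 2))) atTop
        (nhds (α * M + β * M1)) := by
    intro α β hq
    rw [tendsto_iff_dist_tendsto_zero]
    have hz : Tendsto (fun t => Real.exp (-(d / A) * t) * A * A * Lm) atTop (nhds 0) := by
      simpa using (hexpA.mul_const A).mul_const Lm
    refine squeeze_zero' (Eventually.of_forall fun t => dist_nonneg) ?_ hz
    filter_upwards [eventually_gt_atTop 0] with t ht
    have hi : (∫ x in (g t)..(h t), δ * (α + β * x))
        = δ * (α * (h t - g t) + β * ((h t ^ 2 - g t ^ 2) / 2)) := by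
      rw [intervalIntegral.integral_const_mul, intervalIntegral.integral_add
        intervalIntegrable_const ((by fun_prop : Continuous fun x : ℝ => β * x).intervalIntegrable _ _),
        intervalIntegral.integral_const, intervalIntegral.integral_const_mul, integral_id,
        smul_eq_mul]
      ring
    rw [← hi, ← hJ α β t ht, Real.dist_eq, ← intervalIntegral.integral_sub
      ((by fun_prop : Continuous fun x : ℝ => δ * (α + β * x)).intervalIntegrable _ _)
      (hii α β t ht.le)]
    have hL := hlt t ht.le
    have hb : ∀ x ∈ Set.uIoc (g t) (h t), ‖δ * (α + β * x) - u t x * (α + β * x)‖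
        ≤ Real.exp (-(d / A) * t) * A * A := by
      intro x hx
      rw [uIoc_of_le hL.le] at hx
      have hx' : x ∈ Icc (g t) (h t) := ⟨hx.1.le, hx.2⟩
      rw [← sub_mul, Real.norm_eq_abs, abs_mul, abs_sub_comm]
      exact mul_le_mul (hdec t ht.le x hx') (hq t ht.le x hx') (abs_nonneg _)
        (mul_nonneg (Real.exp_pos _).le hApos.le)
    have h1 := intervalIntegral.norm_integral_le_of_norm_le_const hb
    rw [Real.norm_eq_abs, abs_of_pos (sub_pos.2 hL)] at h1
    refine h1.trans (mul_le_mul_of_nonneg_left (hlen' t ht) ?_)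
    exact mul_nonneg (mul_nonneg (Real.exp_pos _).le hApos.le) hApos.le
  have hA1 : 1 ≤ A := by
    have := sq_nonneg (|c| + Lm)
    have := sq_nonneg h₀
    linarith
  have t0 := hmom 1 0 (fun t ht x hx => by simpa using hA1)
  have t1 := hmom 0 1 (fun t ht x hx => by
    have := hA t ht x hx
    rw [zero_add, one_mul]
    rw [abs_le]
    constructor <;> nlinarith [sq_nonneg (x - 1), sq_nonneg (x + 1)])
  simp only [one_mul, zero_mul, add_zero, zero_add] at t0 t1
  have tD : Tendsto (fun t => h t - g t) atTop (nhds (M / δ)) := by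
    refine (t0.div_const δ).congr fun t => ?_
    field_simp
  have tS : Tendsto (fun t => h t + g t) atTop (nhds (2 * (M1 / M))) := by
    have := (t1.div t0 hMpos.ne').const_mul 2
    refine this.congr' ?_
    filter_upwards [eventually_ge_atTop 0] with t ht
    have := sub_pos.2 (hlt t ht)
    simp only [Pi.div_apply]
    field_simp
    ring
  refine ⟨(2 * (M1 / M) - M / δ) / 2, (2 * (M1 / M) + M / δ) / 2, ?_, ?_, ?_⟩
  · exact ((tS.sub tD).div_const 2).congr fun t => by ring
  · exact ((tS.add tD).div_const 2).congr fun t => by ring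
  · field_simp
    ring
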